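/- Let b be a slowly varying function, q ∈ (0,∞] and p ∈ (1,∞]. Then there is a constant C such that ‖f‖_{(p,q,b)} ≤ C ‖f‖_{p,q,b} for every μ-measurable f. -/

import Mathlib

open MeasureTheory Set Filter ENNReal Topology

noncomputable section

/-- `f ≈ g` on `S`: two-sided equivalence with positive constants. -/
def EquivOn (f g : ℝ → ℝ) (S : Set ℝ) : Prop :=
  ∃ c C : ℝ, 0 < c ∧ 0 < C ∧ ∀ t ∈ S, c * g t ≤ f t ∧ f t ≤ C * g t

/-- A measurable positive function on `(0,∞)` is slowly varying if for every `ε > 0`,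
`t ^ ε * b t` is equivalent to a non-decreasing function and `t ^ (-ε) * b t` is
equivalent to a non-increasing function on `(0,∞)`. -/
def IsSlowlyVarying (b : ℝ → ℝ) : Prop :=
  Measurable b ∧ (∀ t ∈ Set.Ioi (0:ℝ), 0 < b t) ∧
    ∀ ε : ℝ, 0 < ε →
      (∃ bp : ℝ → ℝ, MonotoneOn bp (Set.Ioi 0) ∧
        EquivOn (fun t => t ^ ε * b t) bp (Set.Ioi 0)) ∧
      (∃ bm : ℝ → ℝ, AntitoneOn bm (Set.Ioi 0) ∧
        EquivOn (fun t => t ^ (-ε) * b t) bm (Set.Ioi 0))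

/-- The non-increasing rearrangement `f*` (with values in `ℝ≥0∞`). -/
def rearr {X : Type*} [MeasurableSpace X] (μ : Measure X) (f : X → ℝ) (t : ℝ) : ℝ≥0∞ :=
  sInf {s : ℝ≥0∞ | μ {x | s < ENNReal.ofReal |f x|} ≤ ENNReal.ofReal t}

/-- The maximal function `f**(t) = (1/t) ∫₀ᵗ f*`. -/
def maxf {X : Type*} [MeasurableSpace X] (μ : Measure X) (f : X → ℝ) (t : ℝ) : ℝ≥0∞ :=
  (ENNReal.ofReal t)⁻¹ * ∫⁻ s in Set.Ioo (0:ℝ) t, rearr μ f s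

/-- The `L^q` "norm" over a subset `S ⊆ ℝ` of an `ℝ≥0∞`-valued function. -/
def lqNorm (q : ℝ≥0∞) (S : Set ℝ) (g : ℝ → ℝ≥0∞) : ℝ≥0∞ :=
  if q = ∞ then essSup g (volume.restrict S)
  else (∫⁻ t in S, g t ^ q.toReal) ^ (1 / q.toReal)

/-- The Lorentz–Karamata functional `‖f‖_{p,q,b}`. -/
def lkNorm {X : Type*} [MeasurableSpace X] (μ : Measure X) (p q : ℝ≥0∞) (b : ℝ → ℝ)
    (f : X → ℝ) : ℝ≥0∞ :=
  lqNorm q (Set.Ioi 0)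
    (fun t => ENNReal.ofReal (t ^ (p⁻¹.toReal - q⁻¹.toReal) * b t) * rearr μ f t)

/-- The Lorentz–Karamata functional `‖f‖_{(p,q,b)}` defined via the maximal function. -/
def lkMaxNorm {X : Type*} [MeasurableSpace X] (μ : Measure X) (p q : ℝ≥0∞) (b : ℝ → ℝ)
    (f : X → ℝ) : ℝ≥0∞ :=
  lqNorm q (Set.Ioi 0)
    (fun t => ENNReal.ofReal (t ^ (p⁻¹.toReal - q⁻¹.toReal) * b t) * maxf μ f t)

/-- The `L^q(0,∞)` norm of `t ^ (1/p - 1/q) * b t` restricted to `S`. -/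
def weightNorm (p q : ℝ≥0∞) (b : ℝ → ℝ) (S : Set ℝ) : ℝ≥0∞ :=
  lqNorm q S (fun t => ENNReal.ofReal (t ^ (p⁻¹.toReal - q⁻¹.toReal) * b t))

/-- A measure is non-atomic. -/
def IsNonatomic {X : Type*} [MeasurableSpace X] (μ : Measure X) : Prop :=
  ∀ s : Set X, MeasurableSet s → 0 < μ s →
    ∃ t, t ⊆ s ∧ MeasurableSet t ∧ 0 < μ t ∧ μ t < μ s

/-- `b̃(t) = ∫₀ᵗ s⁻¹ b(s) ds`. -/
def svTilde (b : ℝ → ℝ) (t : ℝ) : ℝ≥0∞ :=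
  ∫⁻ s in Set.Ioo (0:ℝ) t, ENNReal.ofReal (s⁻¹ * b s)

/-- `b̃_∞(t) = esssup_{s ∈ (0,t)} b(s)`. -/
def svTildeSup (b : ℝ → ℝ) (t : ℝ) : ℝ≥0∞ :=
  essSup (fun s => ENNReal.ofReal (b s)) (volume.restrict (Set.Ioo (0:ℝ) t))

/-- `b̂(t) = ∫_t^∞ s⁻¹ b(s) ds`. -/
def svHat (b : ℝ → ℝ) (t : ℝ) : ℝ≥0∞ :=
  ∫⁻ s in Set.Ioi t, ENNReal.ofReal (s⁻¹ * b s)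

/-- `b̂_∞(t) = esssup_{s ∈ (t,∞)} b(s)`. -/
def svHatSup (b : ℝ → ℝ) (t : ℝ) : ℝ≥0∞ :=
  essSup (fun s => ENNReal.ofReal (b s)) (volume.restrict (Set.Ioi t))

/-- The associate functional of a functional `N`. -/
def assocNorm {X : Type*} [MeasurableSpace X] (μ : Measure X) (N : (X → ℝ) → ℝ≥0∞)
    (f : X → ℝ) : ℝ≥0∞ :=
  ⨆ (g : X → ℝ) (_ : Measurable g) (_ : N g ≤ 1), ∫⁻ x, ENNReal.ofReal |f x * g x| ∂μ

/-- The conjugate exponent: `q' = q/(q-1)` for `q ∈ (1,∞)`, `1' = ∞`, `∞' = 1`. -/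
def conjE (q : ℝ≥0∞) : ℝ≥0∞ := (1 - q⁻¹)⁻¹

/-- The interval `(0, μ(R))` inside `ℝ`, where `μ(R)` may be infinite. -/
def IooMu {X : Type*} [MeasurableSpace X] (μ : Measure X) : Set ℝ :=
  {t : ℝ | 0 < t ∧ ENNReal.ofReal t < μ Set.univ}

/-- The embedding `L^{p₁,q₁,b₁} ↪ L^{p₂,q₂,b₂}`. -/
def lkEmbed {X : Type*} [MeasurableSpace X] (μ : Measure X) (p1 q1 : ℝ≥0∞) (b1 : ℝ → ℝ)
    (p2 q2 : ℝ≥0∞) (b2 : ℝ → ℝ) : Prop :=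
  ∃ C : ℝ≥0∞, C < ∞ ∧ ∀ f : X → ℝ, Measurable f →
    lkNorm μ p2 q2 b2 f ≤ C * lkNorm μ p1 q1 b1 f

/-- A rearrangement-invariant quasi-Banach function norm. -/
structure IsRIQuasiBFN {X : Type*} [MeasurableSpace X] (μ : Measure X)
    (N : (X → ℝ) → ℝ≥0∞) : Prop where
  abs_eq : ∀ f : X → ℝ, Measurable f → N (fun x => |f x|) = N f
  smul : ∀ (a : ℝ) (f : X → ℝ), Measurable f →
    N (fun x => a * f x) = ENNReal.ofReal |a| * N f
  eq_zero_iff : ∀ f : X → ℝ, Measurable f → (N f = 0 ↔ f =ᵐ[μ] 0)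
  quasi_add : ∃ C : ℝ≥0∞, C < ∞ ∧ ∀ f g : X → ℝ, Measurable f → Measurable g →
    N (fun x => f x + g x) ≤ C * (N f + N g)
  mono : ∀ f g : X → ℝ, Measurable f → Measurable g →
    (∀ᵐ x ∂μ, |f x| ≤ |g x|) → N f ≤ N g
  fatou : ∀ (f : ℕ → X → ℝ) (g : X → ℝ), (∀ n, Measurable (f n)) → Measurable g →
    (∀ᵐ x ∂μ, ∀ n, 0 ≤ f n x) → (∀ᵐ x ∂μ, Monotone fun n => f n x) →
    (∀ᵐ x ∂μ, Filter.Tendsto (fun n => f n x) Filter.atTop (nhds (g x))) →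
    N g = ⨆ n, N (f n)
  ind_lt_top : ∀ E : Set X, MeasurableSet E → μ E < ∞ →
    N (Set.indicator E fun _ => (1:ℝ)) < ∞
  rearr_inv : ∀ f g : X → ℝ, Measurable f → Measurable g →
    rearr μ f = rearr μ g → N f = N g

/-- A rearrangement-invariant Banach function norm. -/
structure IsRIBFN {X : Type*} [MeasurableSpace X] (μ : Measure X)
    (N : (X → ℝ) → ℝ≥0∞) : Prop where
  abs_eq : ∀ f : X → ℝ, Measurable f → N (fun x => |f x|) = N f
  smul : ∀ (a : ℝ) (f : X → ℝ), Measurable f →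
    N (fun x => a * f x) = ENNReal.ofReal |a| * N f
  eq_zero_iff : ∀ f : X → ℝ, Measurable f → (N f = 0 ↔ f =ᵐ[μ] 0)
  add_le : ∀ f g : X → ℝ, Measurable f → Measurable g →
    N (fun x => f x + g x) ≤ N f + N g
  mono : ∀ f g : X → ℝ, Measurable f → Measurable g →
    (∀ᵐ x ∂μ, |f x| ≤ |g x|) → N f ≤ N g
  fatou : ∀ (f : ℕ → X → ℝ) (g : X → ℝ), (∀ n, Measurable (f n)) → Measurable g →
    (∀ᵐ x ∂μ, ∀ n, 0 ≤ f n x) → (∀ᵐ x ∂μ, Monotone fun n => f n x) →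
    (∀ᵐ x ∂μ, Filter.Tendsto (fun n => f n x) Filter.atTop (nhds (g x))) →
    N g = ⨆ n, N (f n)
  ind_lt_top : ∀ E : Set X, MeasurableSet E → μ E < ∞ →
    N (Set.indicator E fun _ => (1:ℝ)) < ∞
  integral_le : ∀ E : Set X, MeasurableSet E → μ E < ∞ →
    ∃ C : ℝ≥0∞, C < ∞ ∧ ∀ f : X → ℝ, Measurable f →
      ∫⁻ x in E, ENNReal.ofReal |f x| ∂μ ≤ C * N f
  rearr_inv : ∀ f g : X → ℝ, Measurable f → Measurable g →
    rearr μ f = rearr μ g → N f = N g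

end

/-- The rearrangement is non-increasing. -/
lemma rearr_antitone {X : Type*} [MeasurableSpace X] (μ : Measure X) (f : X → ℝ) :
    Antitone (rearr μ f) := fun _ _ hst =>
  sInf_le_sInf fun _ hu => le_trans hu (ENNReal.ofReal_le_ofReal hst)

/-- A slowly varying function grows at most like a small power, uniformly. -/
lemma IsSlowlyVarying.exists_le_rpow_mul {b : ℝ → ℝ} (hb : IsSlowlyVarying b) {ε : ℝ}
    (hε : 0 < ε) :
    ∃ K : ℝ, 0 < K ∧ ∀ s t : ℝ, 0 < s → s ≤ t → t ^ (-ε) * b t ≤ K * (s ^ (-ε) * b s) := by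
  obtain ⟨-, bm, hanti, c, C, hc, hC, h⟩ := hb.2.2 ε hε
  refine ⟨C / c, by positivity, fun s t hs hst => ?_⟩
  have ht : 0 < t := hs.trans_le hst
  calc t ^ (-ε) * b t ≤ C * bm t := (h t ht).2
    _ ≤ C * bm s := by gcongr; exact hanti hs ht hst
    _ = C / c * (c * bm s) := by field_simp
    _ ≤ C / c * (s ^ (-ε) * b s) := mul_le_mul_of_nonneg_left (h s hs).1 (by positivity)

/-- Dyadic bound for the average of a non-increasing function. -/
lemma setLIntegral_Ioo_le_tsum_dyadic {g : ℝ → ℝ≥0∞} (hg : Antitone g) {t : ℝ} (ht : 0 < t) :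
    ∫⁻ s in Ioo 0 t, g s ≤
      ∑' k : ℕ, g ((1 / 2) ^ (k + 1) * t) * ENNReal.ofReal ((1 / 2) ^ (k + 1) * t) := by
  have hsub : Ioo 0 t ⊆ ⋃ k : ℕ, Ioc ((1 / 2) ^ (k + 1) * t) ((1 / 2) ^ k * t) := by
    rintro s ⟨hs, hst⟩
    obtain ⟨k, hk, hk'⟩ := exists_nat_pow_near_of_lt_one (div_pos hs ht)
      ((div_le_one ht).2 hst.le) (one_half_pos (α := ℝ)) one_half_lt_one
    exact mem_iUnion.2 ⟨k, (lt_div_iff₀ ht).1 hk, (div_le_iff₀ ht).1 hk'⟩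
  calc ∫⁻ s in Ioo 0 t, g s
      ≤ ∫⁻ s in ⋃ k : ℕ, Ioc ((1 / 2) ^ (k + 1) * t) ((1 / 2) ^ k * t), g s :=
        lintegral_mono_set hsub
    _ ≤ ∑' k : ℕ, ∫⁻ s in Ioc ((1 / 2) ^ (k + 1) * t) ((1 / 2) ^ k * t), g s :=
        lintegral_iUnion_le _ _
    _ ≤ _ := by
        refine ENNReal.tsum_le_tsum fun k => ?_
        calc _ ≤ ∫⁻ _ in Ioc ((1 / 2) ^ (k + 1) * t) ((1 / 2) ^ k * t),
                g ((1 / 2) ^ (k + 1) * t) :=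
              setLIntegral_mono measurable_const fun s hs => hg hs.1.le
          _ = _ := by
              rw [setLIntegral_const, Real.volume_Ioc]
              congr 2
              ring

/-- Dyadic bound for the maximal function. -/
lemma maxf_le_tsum_dyadic {X : Type*} [MeasurableSpace X] (μ : Measure X) (f : X → ℝ) {t : ℝ}
    (ht : 0 < t) :
    maxf μ f t ≤
      ∑' k : ℕ, ENNReal.ofReal ((1 / 2) ^ (k + 1)) * rearr μ f ((1 / 2) ^ (k + 1) * t) := by
  unfold maxf
  calc _ ≤ (ENNReal.ofReal t)⁻¹ * ∑' k : ℕ, rearr μ f ((1 / 2) ^ (k + 1) * t) *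
        ENNReal.ofReal ((1 / 2) ^ (k + 1) * t) := by
        gcongr
        exact setLIntegral_Ioo_le_tsum_dyadic (rearr_antitone μ f) ht
    _ = _ := by
        rw [← ENNReal.tsum_mul_left]
        refine tsum_congr fun k => ?_
        have h0 : ENNReal.ofReal t ≠ 0 := by simpa using ht
        rw [ENNReal.ofReal_mul (by positivity)]
        calc _ = (ENNReal.ofReal t)⁻¹ * ENNReal.ofReal t * (ENNReal.ofReal ((1 / 2) ^ (k + 1)) *
              rearr μ f ((1 / 2) ^ (k + 1) * t)) := by ring
          _ = _ := by rw [ENNReal.inv_mul_cancel h0 ENNReal.ofReal_ne_top, one_mul]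

/-- Behaviour of the Lorentz–Karamata weight under dyadic dilations. -/
lemma IsSlowlyVarying.exists_weight_dilation {b : ℝ → ℝ} (hb : IsSlowlyVarying b) {P Q ε : ℝ}
    (hε : 0 < ε) (hP : P + 3 * ε = 1) :
    ∃ K : ℝ, 0 < K ∧ ∀ (n : ℕ) (t : ℝ), 0 < t →
      t ^ (P - Q) * b t * (1 / 2) ^ n ≤
        K * ((2 ^ (-ε)) ^ n * ((2 ^ (-ε)) ^ n * (2 ^ (-Q)) ^ n *
          (((1 / 2) ^ n * t) ^ (P - Q) * b ((1 / 2) ^ n * t)))) := by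
  obtain ⟨K, hK, h⟩ := hb.exists_le_rpow_mul hε
  refine ⟨K, hK, fun n t ht => ?_⟩
  have hl : (0 : ℝ) < (1 / 2) ^ n := by positivity
  have hs : 0 < (1 / 2) ^ n * t := by positivity
  have key := h _ t hs (mul_le_of_le_one_left ht.le (pow_le_one₀ (by norm_num) (by norm_num)))
  have hpow : ∀ a : ℝ, ((2 : ℝ) ^ (-a)) ^ n = ((1 / 2 : ℝ) ^ n) ^ a := fun a => by
    rw [← Real.rpow_natCast, ← Real.rpow_natCast, ← Real.rpow_mul (by norm_num),
      ← Real.rpow_mul (by norm_num), one_div, Real.inv_rpow (by norm_num),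
      ← Real.rpow_neg (by norm_num)]
    congr 1
    ring
  rw [hpow, hpow]
  set l : ℝ := (1 / 2) ^ n
  have hlexp : l ^ ε * (l ^ ε * l ^ Q * l ^ (P - Q)) = l * l ^ (-ε) := by
    nth_rewrite 5 [← Real.rpow_one l]
    simp only [← Real.rpow_add hl]
    congr 1
    linarith
  have htexp : t ^ ε * t ^ (-ε) = 1 := by rw [← Real.rpow_add ht]; simp
  rw [Real.mul_rpow hl.le ht.le] at key ⊢
  calc t ^ (P - Q) * b t * l = (t ^ (P - Q) * t ^ ε * l) * (t ^ (-ε) * b t) := by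
        linear_combination (-(t ^ (P - Q) * b t * l)) * htexp
    _ ≤ (t ^ (P - Q) * t ^ ε * l) * (K * (l ^ (-ε) * t ^ (-ε) * b (l * t))) := by gcongr
    _ = _ := by
        linear_combination (K * t ^ (P - Q) * b (l * t) * l * l ^ (-ε)) * htexp -
          (K * t ^ (P - Q) * b (l * t)) * hlexp

/-- Change of variables for dilations of the half-line. -/
lemma setLIntegral_Ioi_comp_mul_left {F : ℝ → ℝ≥0∞} (hF : Measurable F) {a : ℝ} (ha : 0 < a) :
    ∫⁻ t in Ioi 0, F (a * t) = ENNReal.ofReal a⁻¹ * ∫⁻ t in Ioi 0, F t := by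
  have hpre : (a * ·) ⁻¹' Ioi 0 = Ioi (0 : ℝ) := by
    ext x
    simp [ha]
  have h := setLIntegral_map (μ := volume) (measurableSet_Ioi (a := (0 : ℝ))) hF
    (measurable_const_mul a)
  rw [hpre, Real.map_volume_mul_left ha.ne', Measure.restrict_smul, lintegral_smul_measure,
    abs_of_pos (inv_pos.2 ha)] at h
  exact h.symm

/-- A geometric series with ratio less than one, starting at the first power, is finite. -/
lemma tsum_pow_succ_lt_top {r : ℝ≥0∞} (hr : r < 1) : ∑' k : ℕ, r ^ (k + 1) < ∞ := by
  rw [ENNReal.tsum_geometric_add_one]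
  exact ENNReal.mul_lt_top (hr.trans one_lt_top) (ENNReal.inv_lt_top.2 (tsub_pos_of_lt hr))

/-- A function dominated by a geometrically weighted sum of dilates of `F` has its `L^q` norm
controlled by that of `F`. -/
lemma exists_lqNorm_le_of_le_tsum_dilates {q r : ℝ≥0∞} (hq : 0 < q) (hr : r < 1) {K : ℝ≥0∞}
    (hK : K < ∞) :
    ∃ C : ℝ≥0∞, C < ∞ ∧ ∀ F G : ℝ → ℝ≥0∞, Measurable F →
      (∀ t, 0 < t → G t ≤ K * ∑' k : ℕ, r ^ (k + 1) * (r ^ (k + 1) *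
        ENNReal.ofReal (2 ^ (-q⁻¹.toReal)) ^ (k + 1) * F ((1 / 2) ^ (k + 1) * t))) →
      lqNorm q (Ioi 0) G ≤ C * lqNorm q (Ioi 0) F := by
  set S : ℝ≥0∞ := ∑' k : ℕ, r ^ (k + 1) with hS
  have hSt : S < ∞ := tsum_pow_succ_lt_top hr
  by_cases hqt : q = ∞
  · subst hqt
    refine ⟨K * S, ENNReal.mul_lt_top hK hSt, fun F G hF hG => ?_⟩
    simp only [lqNorm, if_true]
    set N := essSup F (volume.restrict (Ioi 0))
    have hae : ∀ᵐ t ∂volume.restrict (Ioi (0 : ℝ)), ∀ k : ℕ, F ((1 / 2) ^ (k + 1) * t) ≤ N := by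
      refine ae_all_iff.2 fun k => ?_
      have hz : ∫⁻ t in Ioi (0 : ℝ), {x | N < F x}.indicator 1 t = 0 := by
        rw [lintegral_indicator_one (measurableSet_lt measurable_const hF)]
        simpa only [not_le] using
          ae_iff.1 (ENNReal.ae_le_essSup (μ := volume.restrict (Ioi 0)) F)
      have hm : Measurable ({x | N < F x}.indicator (1 : ℝ → ℝ≥0∞)) :=
        measurable_one.indicator (measurableSet_lt measurable_const hF)
      have := setLIntegral_Ioi_comp_mul_left hm (a := (1 / 2) ^ (k + 1)) (by positivity)
      rw [hz, mul_zero, lintegral_eq_zero_iff (by fun_prop)] at this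
      filter_upwards [this] with t ht
      simpa [indicator] using ht
    refine essSup_le_of_ae_le _ ?_
    filter_upwards [hae, ae_restrict_mem measurableSet_Ioi] with t ht ht0
    refine (hG t ht0).trans ?_
    rw [mul_assoc, hS, ← ENNReal.tsum_mul_right]
    gcongr with k
    simp only [inv_top, toReal_zero, neg_zero, Real.rpow_zero, ofReal_one, one_pow, mul_one]
    calc r ^ (k + 1) * F _ ≤ 1 * N := by
          gcongr
          · exact pow_le_one₀ zero_le hr.le
          · exact ht k
      _ = N := one_mul N
  · have hqr : 0 < q.toReal := ENNReal.toReal_pos hq.ne' hqt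
    set h : ℝ≥0∞ := ENNReal.ofReal (2 ^ (-q⁻¹.toReal))
    have hh : ∀ k : ℕ, (h ^ (k + 1)) ^ q.toReal * ENNReal.ofReal ((1 / 2) ^ (k + 1))⁻¹ = 1 := by
      intro k
      have hhq : h ^ q.toReal = ENNReal.ofReal (1 / 2) := by
        rw [ENNReal.ofReal_rpow_of_pos (by positivity), ← Real.rpow_mul (by norm_num),
          ENNReal.toReal_inv, neg_mul, inv_mul_cancel₀ hqr.ne', Real.rpow_neg_one, one_div]
      rw [← ENNReal.rpow_natCast, ← ENNReal.rpow_mul, mul_comm, mul_comm _ q.toReal,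
        ENNReal.rpow_mul, hhq, ENNReal.rpow_natCast, ← ENNReal.ofReal_pow (by norm_num),
        ← ENNReal.ofReal_mul (by positivity), inv_mul_cancel₀ (by positivity), ofReal_one]
    set T : ℝ≥0∞ := ∑' k : ℕ, (r ^ q.toReal) ^ (k + 1) with hT
    have hTt : T < ∞ := tsum_pow_succ_lt_top (ENNReal.rpow_lt_one hr hqr)
    refine ⟨K * S * T ^ (1 / q.toReal), ENNReal.mul_lt_top (ENNReal.mul_lt_top hK hSt)
      (ENNReal.rpow_lt_top_of_nonneg (by positivity) hTt.ne), fun F G hF hG => ?_⟩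
    simp only [lqNorm, if_neg hqt]
    have hpt : ∀ t ∈ Ioi (0 : ℝ), G t ^ q.toReal ≤ (K * S) ^ q.toReal * ∑' k : ℕ,
        (r ^ q.toReal) ^ (k + 1) * (h ^ (k + 1)) ^ q.toReal *
          F ((1 / 2) ^ (k + 1) * t) ^ q.toReal := by
      intro t ht
      set A := ∑' k : ℕ, (r ^ q.toReal) ^ (k + 1) * (h ^ (k + 1)) ^ q.toReal *
          F ((1 / 2) ^ (k + 1) * t) ^ q.toReal with hA
      have hterm : ∀ k : ℕ,
          r ^ (k + 1) * h ^ (k + 1) * F ((1 / 2) ^ (k + 1) * t) ≤ A ^ (1 / q.toReal) := by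
        intro k
        rw [one_div q.toReal, ENNReal.le_rpow_inv_iff hqr]
        refine le_trans (le_of_eq ?_) (ENNReal.le_tsum k)
        rw [ENNReal.mul_rpow_of_nonneg _ _ hqr.le, ENNReal.mul_rpow_of_nonneg _ _ hqr.le]
        congr 2
        rw [← ENNReal.rpow_natCast, ← ENNReal.rpow_natCast, ← ENNReal.rpow_mul,
          ← ENNReal.rpow_mul, mul_comm]
      have hle : G t ≤ K * S * A ^ (1 / q.toReal) := by
        refine (hG t ht).trans ?_
        rw [mul_assoc, hS, ← ENNReal.tsum_mul_right]
        gcongr with k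
        exact hterm k
      calc G t ^ q.toReal ≤ (K * S * A ^ (1 / q.toReal)) ^ q.toReal := by gcongr
        _ = _ := by
          rw [ENNReal.mul_rpow_of_nonneg _ _ hqr.le, ← ENNReal.rpow_mul,
            one_div_mul_cancel hqr.ne', ENNReal.rpow_one]
    have hint : ∫⁻ t in Ioi 0, G t ^ q.toReal ≤
        (K * S) ^ q.toReal * (T * ∫⁻ t in Ioi 0, F t ^ q.toReal) := by
      calc _ ≤ ∫⁻ t in Ioi 0, (K * S) ^ q.toReal * ∑' k : ℕ,
            (r ^ q.toReal) ^ (k + 1) * (h ^ (k + 1)) ^ q.toReal *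
              F ((1 / 2) ^ (k + 1) * t) ^ q.toReal :=
            setLIntegral_mono' measurableSet_Ioi hpt
        _ = _ := by
            rw [lintegral_const_mul _ (by fun_prop), lintegral_tsum (fun k => by fun_prop), hT,
              ← ENNReal.tsum_mul_right]
            congr 1
            refine tsum_congr fun k => ?_
            rw [lintegral_const_mul _ (by fun_prop),
              setLIntegral_Ioi_comp_mul_left (F := fun t => F t ^ q.toReal) (by fun_prop)
                (by positivity), ← mul_assoc, mul_assoc (_ ^ (k + 1)), hh, mul_one]
    calc _ ≤ ((K * S) ^ q.toReal * (T * ∫⁻ t in Ioi 0, F t ^ q.toReal)) ^ (1 / q.toReal) := by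
          gcongr
      _ = _ := by
          rw [ENNReal.mul_rpow_of_nonneg _ _ (by positivity),
            ENNReal.mul_rpow_of_nonneg T _ (by positivity), ← ENNReal.rpow_mul,
            mul_one_div_cancel hqr.ne', ENNReal.rpow_one, ← mul_assoc]

/-- Theorem TEQN: for `p > 1`, `‖f‖_{(p,q,b)} ≲ ‖f‖_{p,q,b}`. -/
theorem lkMaxNorm_le_lkNorm {X : Type*} [MeasurableSpace X] (μ : Measure X)
    [SigmaFinite μ] (hna : IsNonatomic μ) (hμ : μ Set.univ = ∞)
    (p q : ℝ≥0∞) (hq : 0 < q) (hp : 1 < p) (b : ℝ → ℝ) (hb : IsSlowlyVarying b) :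
    ∃ C : ℝ≥0∞, C < ∞ ∧ ∀ f : X → ℝ, Measurable f →
      lkMaxNorm μ p q b f ≤ C * lkNorm μ p q b f := by
  obtain ⟨ε, hε, hP⟩ : ∃ ε : ℝ, 0 < ε ∧ p⁻¹.toReal + 3 * ε = 1 := by
    have hlt : p⁻¹.toReal < 1 := by
      simpa using ENNReal.toReal_strict_mono one_ne_top (ENNReal.inv_lt_one.2 hp)
    exact ⟨(1 - p⁻¹.toReal) / 3, by linarith, by ring⟩
  obtain ⟨K, hK, hw⟩ := hb.exists_weight_dilation (Q := q⁻¹.toReal) hε hP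
  have hr : ENNReal.ofReal (2 ^ (-ε)) < 1 := by
    rw [ENNReal.ofReal_lt_one]
    exact Real.rpow_lt_one_of_one_lt_of_neg one_lt_two (by linarith)
  obtain ⟨C, hC, h⟩ := exists_lqNorm_le_of_le_tsum_dilates hq hr (ofReal_lt_top (r := K))
  refine ⟨C, hC, fun f _ => h _ _ ?_ fun t ht => ?_⟩
  · have := hb.1
    have := (rearr_antitone μ f).measurable
    fun_prop
  · refine (mul_le_mul_right (maxf_le_tsum_dyadic μ f ht) _).trans ?_
    rw [← ENNReal.tsum_mul_left, ← ENNReal.tsum_mul_left]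
    refine ENNReal.tsum_le_tsum fun k => ?_
    have hbt := hb.2.1 t ht
    have hle := ENNReal.ofReal_le_ofReal (hw (k + 1) t ht)
    rw [ENNReal.ofReal_mul (q := (1 / 2) ^ (k + 1)) (by positivity),
      ENNReal.ofReal_mul (p := K) hK.le,
      ENNReal.ofReal_mul (p := (2 ^ (-ε)) ^ (k + 1)) (by positivity),
      ENNReal.ofReal_mul (p := (2 ^ (-ε)) ^ (k + 1) * _) (by positivity),
      ENNReal.ofReal_mul (p := (2 ^ (-ε)) ^ (k + 1)) (by positivity),
      ENNReal.ofReal_pow (p := 2 ^ (-ε)) (by positivity),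
      ENNReal.ofReal_pow (p := 2 ^ (-q⁻¹.toReal)) (by positivity)] at hle
    simpa only [mul_assoc] using mul_le_mul_left hle (rearr μ f ((1 / 2) ^ (k + 1) * t))
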